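/- (Explicit interior minimizer from the proof of Lemma 2.4) Let p > 1, let z_1 > 0 and z_2,…,z_p be real numbers with z_1 > |z_2| > |z_3| > … > |z_p|, and let β_1 > 0. Set nL_p(λ) = (β_1 − η(z_1,λ))² + Σ_{j=2}^p η(z_j,λ)² with soft-threshold η(z,λ) = sgn(z)·max(|z|−λ,0), and consider its restriction to the interval I = [0, z_1). Adopting the convention |z_{p+1}| = 0: (i) if 0 < β_1 ≤ z_1 − |z_2| the minimizer over I is λ = z_1 − β_1; (ii) if for some k with 2 ≤ k ≤ p one has Σ_{j=1}^k |z_j| − k|z_k| < β_1 ≤ Σ_{j=1}^k |z_j| − k|z_{k+1}|, the minimizer over I is λ = (Σ_{j=1}^k |z_j| − β_1)/k; (iii) if β_1 > Σ_{j=1}^p |z_j|, the minimizer over I is λ = 0. -/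

import Mathlib

open Finset

/-- Soft-thresholding operator `η(z, λ) = sgn(z)·max(|z|−λ, 0)`. -/
noncomputable def eta (z lam : ℝ) : ℝ := Real.sign z * max (|z| - lam) 0

/-- Scaled Lasso loss with `p` predictors:
`nL_p(λ) = (β₁ − η(z₁,λ))² + Σ_{j=2}^p η(z_j,λ)²`. -/
noncomputable def nLp (p : ℕ) (z : ℕ → ℝ) (β₁ : ℝ) (lam : ℝ) : ℝ :=
  (β₁ - eta (z 1) lam) ^ 2 + ∑ j ∈ Finset.Icc 2 p, (eta (z j) lam) ^ 2

/-- Scaled Lasso loss with one predictor: `nL_1(λ) = (β₁ − η(z₁,λ))²`. -/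
noncomputable def nL1 (z : ℕ → ℝ) (β₁ : ℝ) (lam : ℝ) : ℝ :=
  (β₁ - eta (z 1) lam) ^ 2

/-- Infimum of a loss function over `λ ≥ 0`. -/
noncomputable def infLoss (f : ℝ → ℝ) : ℝ := ⨅ lam : {l : ℝ // 0 ≤ l}, f lam

/-- For `λ ≥ 0` the square of the soft-thresholding operator is a squared positive part. -/
lemma eta_sq {lam : ℝ} (z : ℝ) (hlam : 0 ≤ lam) :
    eta z lam ^ 2 = max (|z| - lam) 0 ^ 2 := by
  unfold eta
  rcases lt_trichotomy z 0 with h | rfl | h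
  · rw [Real.sign_of_neg h]; ring
  · simp [hlam]
  · rw [Real.sign_of_pos h]; ring

lemma eta_of_pos_of_le {z lam : ℝ} (hz : 0 < z) (h : lam ≤ z) : eta z lam = z - lam := by
  rw [eta, Real.sign_of_pos hz, abs_of_pos hz, max_eq_left (sub_nonneg.2 h), one_mul]

/-- Tangent line inequality for the convex function `x ↦ max (a - x) 0 ^ 2`. -/
lemma sq_max_sub_tangent_le (a x y : ℝ) :
    max (a - x) 0 ^ 2 - 2 * (y - x) * max (a - x) 0 ≤ max (a - y) 0 ^ 2 := by
  rcases max_cases (a - x) 0 with ⟨h, h'⟩ | ⟨h, h'⟩ <;>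
  rcases max_cases (a - y) 0 with ⟨k, k'⟩ | ⟨k, k'⟩ <;> rw [h, k] <;>
  nlinarith [sq_nonneg (x - y)]

/-- Half the derivative of the loss on `[0, z₁)`. -/
noncomputable def nLpSlope (p : ℕ) (z : ℕ → ℝ) (β₁ lam : ℝ) : ℝ :=
  β₁ - z 1 + lam - ∑ j ∈ Finset.Icc 2 p, max (|z j| - lam) 0

/-- Tangent line inequality for the loss on `[0, z₁)`. -/
lemma nLp_tangent_le {p : ℕ} {z : ℕ → ℝ} {β₁ x y : ℝ} (hz1 : 0 < z 1)
    (hx : x ∈ Set.Ico (0 : ℝ) (z 1)) (hy : y ∈ Set.Ico (0 : ℝ) (z 1)) :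
    nLp p z β₁ x + 2 * (y - x) * nLpSlope p z β₁ x ≤ nLp p z β₁ y := by
  have key := Finset.sum_le_sum fun j (_ : j ∈ Finset.Icc 2 p) =>
    sq_max_sub_tangent_le |z j| x y
  rw [Finset.sum_sub_distrib, ← Finset.mul_sum] at key
  unfold nLp nLpSlope
  rw [eta_of_pos_of_le hz1 hx.2.le, eta_of_pos_of_le hz1 hy.2.le]
  simp only [eta_sq _ hx.1, eta_sq _ hy.1]
  nlinarith [sq_nonneg (y - x)]

lemma nLp_le_of_slope_eq_zero {p : ℕ} {z : ℕ → ℝ} {β₁ x y : ℝ} (hz1 : 0 < z 1)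
    (hx : x ∈ Set.Ico (0 : ℝ) (z 1)) (hy : y ∈ Set.Ico (0 : ℝ) (z 1))
    (h : nLpSlope p z β₁ x = 0) : nLp p z β₁ x ≤ nLp p z β₁ y := by
  simpa [h] using nLp_tangent_le (p := p) (β₁ := β₁) hz1 hx hy

lemma abs_le_abs_of_succ_lt {p : ℕ} {z : ℕ → ℝ}
    (hdec : ∀ j, 2 ≤ j → j + 1 ≤ p → |z (j + 1)| < |z j|)
    {i j : ℕ} (hi : 2 ≤ i) (hij : i ≤ j) (hj : j ≤ p) : |z j| ≤ |z i| := by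
  induction j, hij using Nat.le_induction with
  | base => exact le_rfl
  | succ n hn ih => exact (hdec n (hi.trans hn) hj).le.trans (ih (by omega))

lemma sum_Icc_one_abs {z : ℕ → ℝ} (hz1 : 0 < z 1) {k : ℕ} (hk : 1 ≤ k) :
    ∑ j ∈ Finset.Icc 1 k, |z j| = z 1 + ∑ j ∈ Finset.Icc 2 k, |z j| := by
  rw [← Finset.add_sum_Ioc_eq_sum_Icc hk, abs_of_pos hz1]
  rfl

/-- If exactly the indices `j ≤ k` are active at `lam`, the positive parts sum linearly. -/
lemma sum_max_abs_sub {p k : ℕ} {z : ℕ → ℝ} {lam : ℝ} (hk : 1 ≤ k) (hkp : k ≤ p)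
    (hact : ∀ j ∈ Finset.Icc 2 k, lam ≤ |z j|)
    (hinact : ∀ j, k < j → j ≤ p → |z j| ≤ lam) :
    ∑ j ∈ Finset.Icc 2 p, max (|z j| - lam) 0 =
      ∑ j ∈ Finset.Icc 2 k, |z j| - (k - 1) * lam := by
  rw [← Finset.sum_subset (Finset.Icc_subset_Icc_right hkp)]
  · rw [Finset.sum_congr rfl fun j hj => max_eq_left (sub_nonneg.2 (hact j hj)),
      Finset.sum_sub_distrib, Finset.sum_const, Nat.card_Icc, nsmul_eq_mul,
      show k + 1 - 2 = k - 1 by omega, Nat.cast_sub hk, Nat.cast_one]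
  · intro j hj hjk
    rw [Finset.mem_Icc] at hj hjk
    exact max_eq_right (sub_nonpos.2 (hinact j (by omega) hj.2))

/-- (Explicit interior minimizer from the proof of Lemma 2.4) Let `p > 1`, `z₁ > 0`,
`z₁ > |z₂| > … > |z_p|`, and `β₁ > 0`.  With the convention `|z_{p+1}| = 0` (encoded by
`A`), the minimizer of `nL_p` over `I = [0, z₁)` is: (i) `λ = z₁ − β₁` if
`0 < β₁ ≤ z₁ − |z₂|`; (ii) `λ = (Σ_{j=1}^k |z_j| − β₁)/k` if
`Σ_{j=1}^k |z_j| − k|z_k| < β₁ ≤ Σ_{j=1}^k |z_j| − k|z_{k+1}|` for some `2 ≤ k ≤ p`;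
(iii) `λ = 0` if `β₁ > Σ_{j=1}^p |z_j|`. -/
theorem lasso_interior_minimizer (p : ℕ) (hp : 1 < p) (z : ℕ → ℝ) (β₁ : ℝ)
    (hz1 : 0 < z 1) (hβ : 0 < β₁)
    (h12 : |z 2| < z 1)
    (hdec : ∀ j, 2 ≤ j → j + 1 ≤ p → |z (j + 1)| < |z j|)
    (A : ℕ → ℝ) (hA : ∀ j, A j = if j = p + 1 then 0 else |z j|) :
    ((β₁ ≤ z 1 - |z 2|) →
      z 1 - β₁ ∈ Set.Ico (0 : ℝ) (z 1) ∧
      ∀ lam ∈ Set.Ico (0 : ℝ) (z 1), nLp p z β₁ (z 1 - β₁) ≤ nLp p z β₁ lam) ∧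
    (∀ k, 2 ≤ k → k ≤ p →
      (∑ j ∈ Finset.Icc 1 k, |z j|) - (k : ℝ) * |z k| < β₁ →
      β₁ ≤ (∑ j ∈ Finset.Icc 1 k, |z j|) - (k : ℝ) * A (k + 1) →
      ((∑ j ∈ Finset.Icc 1 k, |z j|) - β₁) / k ∈ Set.Ico (0 : ℝ) (z 1) ∧
      ∀ lam ∈ Set.Ico (0 : ℝ) (z 1),
        nLp p z β₁ (((∑ j ∈ Finset.Icc 1 k, |z j|) - β₁) / k) ≤ nLp p z β₁ lam) ∧
    ((∑ j ∈ Finset.Icc 1 p, |z j|) < β₁ →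
      ∀ lam ∈ Set.Ico (0 : ℝ) (z 1), nLp p z β₁ 0 ≤ nLp p z β₁ lam) := by
  have hanti {i j : ℕ} (hi : 2 ≤ i) (hij : i ≤ j) (hj : j ≤ p) : |z j| ≤ |z i| :=
    abs_le_abs_of_succ_lt hdec hi hij hj
  refine ⟨fun h => ?_, fun k hk hkp h₁ h₂ => ?_, fun h lam hlam => ?_⟩
  · have hmem : z 1 - β₁ ∈ Set.Ico (0 : ℝ) (z 1) :=
      ⟨by linarith [abs_nonneg (z 2)], by linarith⟩
    refine ⟨hmem, fun lam hlam => nLp_le_of_slope_eq_zero hz1 hmem hlam ?_⟩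
    rw [nLpSlope, sum_max_abs_sub (k := 1) le_rfl hp.le (by simp)
      fun j hj hjp => (hanti le_rfl hj hjp).trans (by linarith)]
    simp
  · have hk0 : (0 : ℝ) < k := by positivity
    set μ := ((∑ j ∈ Finset.Icc 1 k, |z j|) - β₁) / k with hμ
    have hμk : μ * k = (∑ j ∈ Finset.Icc 1 k, |z j|) - β₁ := div_mul_cancel₀ _ hk0.ne'
    have hlt : μ < |z k| := by rw [hμ, div_lt_iff₀ hk0]; linarith
    have hle : A (k + 1) ≤ μ := by rw [hμ, le_div_iff₀ hk0]; linarith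
    have hA0 : 0 ≤ A (k + 1) := by rw [hA]; split_ifs <;> positivity
    have hmem : μ ∈ Set.Ico (0 : ℝ) (z 1) :=
      ⟨hA0.trans hle, hlt.trans ((hanti le_rfl hk hkp).trans_lt h12)⟩
    refine ⟨hmem, fun lam hlam => nLp_le_of_slope_eq_zero hz1 hmem hlam ?_⟩
    rw [nLpSlope, sum_max_abs_sub (k := k) (by omega) hkp]
    · rw [sum_Icc_one_abs hz1 (by omega)] at hμk
      linarith
    · intro j hj
      rw [Finset.mem_Icc] at hj
      exact hlt.le.trans (hanti hj.1 hj.2 hkp)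
    · intro j hj hjp
      rw [hA, if_neg (by omega)] at hle
      exact (hanti (by omega) hj hjp).trans hle
  · have hslope : 0 ≤ nLpSlope p z β₁ 0 := by
      rw [sum_Icc_one_abs hz1 hp.le] at h
      simp only [nLpSlope, sub_zero, abs_nonneg, max_eq_left]
      linarith
    have key := nLp_tangent_le (p := p) (β₁ := β₁) hz1 ⟨le_rfl, hz1⟩ hlam
    nlinarith [mul_nonneg hlam.1 hslope]
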